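/- Let d, m be positive integers and let A be a real m×d matrix. Suppose there exists α₀ > 0 such that A = α₀ A Aᵀ A (i.e., √α₀ A is a partial isometry) and that A has full row rank (the linear map x ↦ Ax is surjective onto ℝ^m). Let k > 0, set α = α₀ k/(α₀ + k), and let X̂₀ ∈ ℝ^d and y ∈ ℝ^m. Then X̂ = X̂₀ + α Aᵀ (y − A X̂₀) is a global minimizer over ℝ^d of f(X) = ‖X − X̂₀‖₂² + k ‖A X − y‖₂². -/

import Mathlib

open Matrix

/-- A stationary point of a penalized least-squares functional is a global minimizer. -/
theorem penalized_least_squares_le_of_stationary {E F : Type*}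
    [NormedAddCommGroup E] [InnerProductSpace ℝ E]
    [NormedAddCommGroup F] [InnerProductSpace ℝ F]
    (L : E →ₗ[ℝ] F) {k : ℝ} (hk : 0 ≤ k) {x₀ x : E} {y : F}
    (h : ∀ z, inner ℝ (x - x₀) z + k * inner ℝ (L x - y) (L z) = 0) (x' : E) :
    ‖x - x₀‖ ^ 2 + k * ‖L x - y‖ ^ 2 ≤ ‖x' - x₀‖ ^ 2 + k * ‖L x' - y‖ ^ 2 := by
  have h₁ : x' - x₀ = (x - x₀) + (x' - x) := by abel
  have h₂ : L x' - y = (L x - y) + L (x' - x) := by rw [map_sub]; abel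
  rw [h₁, h₂, norm_add_sq_real, norm_add_sq_real]
  have := h (x' - x)
  have : 0 ≤ k * ‖L (x' - x)‖ ^ 2 := by positivity
  nlinarith [sq_nonneg ‖x' - x‖]

theorem inner_toEuclideanLin_transpose {m n : Type*} [Fintype m] [Fintype n]
    [DecidableEq m] [DecidableEq n] (A : Matrix m n ℝ)
    (r : EuclideanSpace ℝ m) (z : EuclideanSpace ℝ n) :
    inner ℝ (Aᵀ.toEuclideanLin r) z = inner ℝ r (A.toEuclideanLin z) := by
  rw [← conjTranspose_eq_transpose_of_trivial, toEuclideanLin_conjTranspose_eq_adjoint,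
    LinearMap.adjoint_inner_left]

/-- A surjective scaled partial isometry is a scaled coisometry. -/
theorem toEuclideanLin_transpose_apply_of_surjective {m n : Type*} [Fintype m] [Fintype n]
    [DecidableEq m] [DecidableEq n] {A : Matrix m n ℝ} {c : ℝ}
    (hA : A = c • (A * Aᵀ * A)) (hsurj : Function.Surjective A.mulVec)
    (r : EuclideanSpace ℝ m) :
    c • A.toEuclideanLin (Aᵀ.toEuclideanLin r) = r := by
  obtain ⟨v, hv⟩ := hsurj r.ofLp
  apply WithLp.ofLp_injective
  have h : c • A *ᵥ (Aᵀ *ᵥ (A *ᵥ v)) = A *ᵥ v := by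
    conv_rhs => rw [hA]
    simp [smul_mulVec, Matrix.mul_assoc]
  rw [hv] at h
  simpa [toLpLin_apply] using h

/-- Theorem 2 of the paper: if `√α₀ A` is a partial isometry
(`A = α₀ A Aᵀ A`) and `A` has full row rank (`x ↦ Ax` is surjective), then for `k > 0`
and `α = α₀k/(α₀+k)`, the CDDB update `X̂ = X̂₀ + α Aᵀ(y − AX̂₀)` is a global minimizer
of `f(X) = ‖X − X̂₀‖² + k‖AX − y‖²`. -/
theorem cddb_update_minimizes
    (d m : ℕ) (hd : 0 < d) (hm : 0 < m)
    (A : Matrix (Fin m) (Fin d) ℝ)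
    (α₀ : ℝ) (hα₀ : 0 < α₀) (hiso : A = α₀ • (A * Aᵀ * A))
    (hsurj : Function.Surjective A.mulVec)
    (k : ℝ) (hk : 0 < k) (α : ℝ) (hα : α = α₀ * k / (α₀ + k))
    (X0 : EuclideanSpace ℝ (Fin d)) (y : EuclideanSpace ℝ (Fin m))
    (Xh : EuclideanSpace ℝ (Fin d))
    (hXh : Xh = X0 + α • (Aᵀ).toEuclideanLin (y - A.toEuclideanLin X0))
    (f : EuclideanSpace ℝ (Fin d) → ℝ)
    (hf : ∀ X, f X = ‖X - X0‖^2 + k * ‖A.toEuclideanLin X - y‖^2) :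
    ∀ X : EuclideanSpace ℝ (Fin d), f Xh ≤ f X := by
  intro X
  rw [hf, hf]
  refine penalized_least_squares_le_of_stationary A.toEuclideanLin hk.le (fun z => ?_) X
  set r := y - A.toEuclideanLin X0 with hr
  have hAr : A.toEuclideanLin (Aᵀ.toEuclideanLin r) = α₀⁻¹ • r :=
    (eq_inv_smul_iff₀ hα₀.ne').2 (toEuclideanLin_transpose_apply_of_surjective hiso hsurj r)
  have hres : A.toEuclideanLin Xh - y = (α * α₀⁻¹ - 1) • r := by
    rw [hXh, map_add, map_smul, hAr, smul_smul, sub_smul, one_smul, hr]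
    abel
  have hstep : Xh - X0 = α • Aᵀ.toEuclideanLin r := by rw [hXh]; abel
  rw [hres, hstep, real_inner_smul_left, real_inner_smul_left, inner_toEuclideanLin_transpose]
  have hcoef : α + k * (α * α₀⁻¹ - 1) = 0 := by
    have : α₀ + k ≠ 0 := by positivity
    rw [hα]
    field_simp
    ring
  linear_combination inner ℝ r (A.toEuclideanLin z) * hcoef
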